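/- Fix μ ≥ 1. Let S and T denote the images in PSL(2,ℤ) of the matrices [[0,−1],[1,0]] and [[1,1],[0,1]] respectively. For any permutations σ_S, σ_R of Fin μ satisfying σ_S² = 1 and σ_R³ = 1, there exists a group homomorphism φ : PSL(2,ℤ) → Perm(Fin μ) with φ(S) = σ_S and φ(S·T) = σ_R. Moreover, if the subgroup generated by σ_S and σ_R acts transitively on Fin μ, then the stabilizer in PSL(2,ℤ) of the point 0 ∈ Fin μ (under the action induced by φ) is a subgroup of PSL(2,ℤ) of index μ. -/

import Mathlib

/-- The subgroup `{±I}` of `SL(2, ℤ)` (the cyclic subgroup generated by `-I`). -/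
def pmOne : Subgroup (Matrix.SpecialLinearGroup (Fin 2) ℤ) := Subgroup.zpowers (-1)

instance pmOne.normal : pmOne.Normal := by
  have hc : ∀ g : Matrix.SpecialLinearGroup (Fin 2) ℤ, Commute g (-1) := fun g =>
    Subtype.coe_injective (by simp)
  constructor
  intro x hx g
  obtain ⟨k, hk⟩ := Subgroup.mem_zpowers_iff.mp hx
  subst hk
  exact Subgroup.mem_zpowers_iff.mpr
    ⟨k, by rw [((hc g).zpow_right k).eq]; group⟩

/-- `PSL(2, ℤ)`, the quotient of `SL(2, ℤ)` by `{±I}`. -/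
abbrev PSL2Z : Type := Matrix.SpecialLinearGroup (Fin 2) ℤ ⧸ pmOne

/-- The image of the matrix `S = [[0, -1], [1, 0]]` in `PSL(2, ℤ)`. -/
def Sbar : PSL2Z := QuotientGroup.mk' pmOne ModularGroup.S

/-- The image of the matrix `T = [[1, 1], [0, 1]]` in `PSL(2, ℤ)`. -/
def Tbar : PSL2Z := QuotientGroup.mk' pmOne ModularGroup.T

open ModularGroup Monoid

/-- The homomorphism `ℤ/n → G` sending the generator to an element `g` with `g ^ n = 1`. -/
def zmodPowHom {G : Type*} [Group G] (n : ℕ) (g : G) (hg : g ^ n = 1) :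
    Multiplicative (ZMod n) →* G :=
  AddMonoidHom.toMultiplicativeLeft
    (ZMod.lift n ⟨zmultiplesHom (Additive G) (Additive.ofMul g), by
      simp [← ofMul_pow, hg]⟩)

lemma zmodPowHom_natCast {G : Type*} [Group G] (n : ℕ) (g : G) (hg : g ^ n = 1) (k : ℕ) :
    zmodPowHom n g hg (Multiplicative.ofAdd (k : ZMod n)) = g ^ k := by
  have h := ZMod.lift_coe n (⟨zmultiplesHom (Additive G) (Additive.ofMul g), by
      simp [← ofMul_pow, hg]⟩ : {f : ℤ →+ Additive G // f n = 0}) k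
  rw [Int.cast_natCast] at h
  exact (congrArg Additive.toMul h).trans (by simp)

/-- The orders of the free factors of `PSL(2, ℤ)`. -/
abbrev factorOrder (i : Bool) : ℕ := bif i then 3 else 2

/-- The family consisting of `ℤ/2` and `ℤ/3`, written multiplicatively. -/
abbrev Factor (i : Bool) : Type := Multiplicative (ZMod (factorOrder i))

/-- The pair of homomorphisms from `ℤ/2` and `ℤ/3` determined by elements with `s ^ 2 = 1` and
`r ^ 3 = 1`. -/
def factorHom {G : Type*} [Group G] (s r : G) (hs : s ^ 2 = 1) (hr : r ^ 3 = 1) :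
    ∀ i : Bool, Factor i →* G
  | false => zmodPowHom 2 s hs
  | true => zmodPowHom 3 r hr

/-- The homomorphism from the free product `ℤ/2 * ℤ/3` determined by elements with `s ^ 2 = 1` and
`r ^ 3 = 1`. -/
def freeProductHom {G : Type*} [Group G] (s r : G) (hs : s ^ 2 = 1) (hr : r ^ 3 = 1) :
    CoprodI Factor →* G :=
  CoprodI.lift (factorHom s r hs hr)

/-- The generator of the factor `ℤ/2` or `ℤ/3` of the free product. -/
def factorGen (i : Bool) : CoprodI Factor :=
  CoprodI.of (i := i) (Multiplicative.ofAdd ((1 : ℕ) : ZMod (factorOrder i)))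

lemma freeProductHom_factorGen_false {G : Type*} [Group G] (s r : G) (hs : s ^ 2 = 1)
    (hr : r ^ 3 = 1) : freeProductHom s r hs hr (factorGen false) = s := by
  rw [freeProductHom, factorGen, CoprodI.lift_of]
  exact (zmodPowHom_natCast 2 s hs 1).trans (pow_one s)

lemma freeProductHom_factorGen_true {G : Type*} [Group G] (s r : G) (hs : s ^ 2 = 1)
    (hr : r ^ 3 = 1) : freeProductHom s r hs hr (factorGen true) = r := by
  rw [freeProductHom, factorGen, CoprodI.lift_of]
  exact (zmodPowHom_natCast 3 r hr 1).trans (pow_one r)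

lemma Sbar_sq : Sbar ^ 2 = 1 := by
  rw [Sbar, ← map_pow]
  refine (QuotientGroup.eq_one_iff _).2 (Subgroup.mem_zpowers_iff.2 ⟨1, ?_⟩)
  ext i j
  fin_cases i <;> fin_cases j <;> simp [pow_succ, coe_S]

lemma Sbar_mul_Tbar_cube : (Sbar * Tbar) ^ 3 = 1 := by
  rw [Sbar, Tbar, ← map_mul, ← map_pow]
  refine (QuotientGroup.eq_one_iff _).2 (Subgroup.mem_zpowers_iff.2 ⟨1, ?_⟩)
  ext i j
  fin_cases i <;> fin_cases j <;> simp [pow_succ, coe_S, coe_T]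

lemma closure_Sbar_Tbar : Subgroup.closure {Sbar, Tbar} = ⊤ := by
  have h := congrArg (Subgroup.map (QuotientGroup.mk' pmOne)) SpecialLinearGroup.SL2Z_generators
  rw [MonoidHom.map_closure, Set.image_pair,
    Subgroup.map_top_of_surjective _ (QuotientGroup.mk'_surjective _)] at h
  exact h

lemma closure_Sbar_Sbar_mul_Tbar : Subgroup.closure {Sbar, Sbar * Tbar} = ⊤ := by
  rw [eq_top_iff, ← closure_Sbar_Tbar, Subgroup.closure_le]
  have hS : Sbar ∈ Subgroup.closure {Sbar, Sbar * Tbar} := Subgroup.subset_closure (by simp)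
  have hR : Sbar * Tbar ∈ Subgroup.closure {Sbar, Sbar * Tbar} :=
    Subgroup.subset_closure (by simp)
  rintro x (rfl | rfl)
  · exact hS
  · exact (Subgroup.mul_mem_cancel_left _ hS).1 hR

/-- The product of the two entries of the first column, as a function on `PSL(2, ℤ)`. -/
def columnProd : PSL2Z → ℤ :=
  Quotient.lift (fun g : Matrix.SpecialLinearGroup (Fin 2) ℤ => g 0 0 * g 1 0) <| by
    intro a b hab
    obtain ⟨k, hk⟩ := Subgroup.mem_zpowers_iff.1 (QuotientGroup.leftRel_apply.1 hab)
    obtain rfl : b = a * (-1) ^ k := by rw [hk, mul_inv_cancel_left]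
    rcases Int.even_or_odd k with h | h
    · simp [h.neg_one_zpow]
    · simp [h.neg_one_zpow]

lemma columnProd_mk (g : Matrix.SpecialLinearGroup (Fin 2) ℤ) :
    columnProd (QuotientGroup.mk' pmOne g) = g 0 0 * g 1 0 := rfl

lemma columnProd_Sbar_mul (x : PSL2Z) : columnProd (Sbar * x) = -columnProd x := by
  obtain ⟨g, rfl⟩ := QuotientGroup.mk'_surjective _ x
  rw [Sbar, ← map_mul, columnProd_mk, columnProd_mk]
  simp [coe_S, Matrix.mul_apply, Fin.sum_univ_two]
  ring

lemma columnProd_Sbar_mul_Tbar_mul_neg {x : PSL2Z} (hx : 0 < columnProd x) :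
    columnProd (Sbar * Tbar * x) < 0 := by
  obtain ⟨g, rfl⟩ := QuotientGroup.mk'_surjective _ x
  rw [columnProd_mk] at hx
  rw [Sbar, Tbar, ← map_mul, ← map_mul, columnProd_mk]
  simp [coe_S, coe_T, Matrix.mul_apply, Fin.sum_univ_two]
  nlinarith [sq_nonneg (g 1 0)]

lemma columnProd_Sbar_mul_Tbar_sq_mul_neg {x : PSL2Z} (hx : 0 < columnProd x) :
    columnProd ((Sbar * Tbar) ^ 2 * x) < 0 := by
  obtain ⟨g, rfl⟩ := QuotientGroup.mk'_surjective _ x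
  rw [columnProd_mk] at hx
  rw [Sbar, Tbar, ← map_mul, ← map_pow, ← map_mul, columnProd_mk]
  simp [coe_S, coe_T, Matrix.mul_apply, Fin.sum_univ_two, pow_two]
  nlinarith [sq_nonneg (g 0 0)]

/-- The ping-pong sets: positive first-column product for `ℤ/2`, negative for `ℤ/3`. -/
def pingPongSet : Bool → Set PSL2Z
  | false => {x | 0 < columnProd x}
  | true => {x | columnProd x < 0}

lemma pingPongSet_nonempty (i : Bool) : (pingPongSet i).Nonempty := by
  cases i
  · refine ⟨QuotientGroup.mk' pmOne ⟨!![1, 0; 1, 1], by simp⟩, ?_⟩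
    change 0 < (1 : ℤ) * 1
    norm_num
  · refine ⟨QuotientGroup.mk' pmOne ⟨!![1, 0; -1, 1], by simp⟩, ?_⟩
    change (1 : ℤ) * -1 < 0
    norm_num

lemma pingPongSet_disjoint : Pairwise (Function.onFun Disjoint pingPongSet) := by
  have h : Disjoint (pingPongSet false) (pingPongSet true) :=
    Set.disjoint_left.2 fun x (hx : 0 < columnProd x) (hy : columnProd x < 0) => lt_asymm hx hy
  rintro (_ | _) (_ | _) hij
  exacts [absurd rfl hij, h, h.symm, absurd rfl hij]

open scoped Pointwise in
lemma factorHom_smul_pingPongSet_subset : Pairwise fun i j => ∀ h : Factor i, h ≠ 1 →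
    factorHom Sbar (Sbar * Tbar) Sbar_sq Sbar_mul_Tbar_cube i h • pingPongSet j ⊆
      pingPongSet i := by
  rintro (_ | _) (_ | _) hij h hh
  · exact absurd rfl hij
  · rintro _ ⟨x, hx, rfl⟩
    have hgen : ∀ k : Multiplicative (ZMod 2), k ≠ 1 →
        k = Multiplicative.ofAdd ((1 : ℕ) : ZMod 2) := by decide
    obtain rfl := hgen h hh
    have hx' : columnProd x < 0 := hx
    change 0 < columnProd (zmodPowHom 2 Sbar Sbar_sq _ * x)
    rw [zmodPowHom_natCast, pow_one, columnProd_Sbar_mul]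
    exact neg_pos.2 hx'
  · rintro _ ⟨x, hx, rfl⟩
    have hx' : 0 < columnProd x := hx
    change columnProd (zmodPowHom 3 (Sbar * Tbar) Sbar_mul_Tbar_cube _ * x) < 0
    have hgen : ∀ k : Multiplicative (ZMod 3), k ≠ 1 →
        k = Multiplicative.ofAdd ((1 : ℕ) : ZMod 3) ∨
          k = Multiplicative.ofAdd ((2 : ℕ) : ZMod 3) := by decide
    obtain rfl | rfl := hgen h hh
    · rw [zmodPowHom_natCast, pow_one]
      exact columnProd_Sbar_mul_Tbar_mul_neg hx'
    · rw [zmodPowHom_natCast]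
      exact columnProd_Sbar_mul_Tbar_sq_mul_neg hx'
  · exact absurd rfl hij

/-- The canonical homomorphism `ℤ/2 * ℤ/3 → PSL(2, ℤ)`. -/
def freeProductToPSL2Z : CoprodI Factor →* PSL2Z :=
  freeProductHom Sbar (Sbar * Tbar) Sbar_sq Sbar_mul_Tbar_cube

lemma freeProductToPSL2Z_injective : Function.Injective freeProductToPSL2Z := by
  refine CoprodI.lift_injective_of_ping_pong _ (Or.inr ⟨true, ?_⟩) pingPongSet
    pingPongSet_nonempty pingPongSet_disjoint factorHom_smul_pingPongSet_subset
  change 3 ≤ Cardinal.mk (ZMod 3)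
  simp [Cardinal.mk_fintype, ZMod.card]

lemma freeProductToPSL2Z_surjective : Function.Surjective freeProductToPSL2Z := by
  rw [← MonoidHom.range_eq_top, eq_top_iff, ← closure_Sbar_Sbar_mul_Tbar, Subgroup.closure_le]
  rintro x (rfl | rfl)
  · exact ⟨_, freeProductHom_factorGen_false ..⟩
  · exact ⟨_, freeProductHom_factorGen_true ..⟩

/-- `PSL(2, ℤ)` is the free product of `ℤ/2` and `ℤ/3`. -/
noncomputable def freeProductEquivPSL2Z : CoprodI Factor ≃* PSL2Z :=
  MulEquiv.ofBijective freeProductToPSL2Z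
    ⟨freeProductToPSL2Z_injective, freeProductToPSL2Z_surjective⟩

theorem exists_monoidHom_PSL2Z {G : Type*} [Group G] (s r : G) (hs : s ^ 2 = 1)
    (hr : r ^ 3 = 1) : ∃ φ : PSL2Z →* G, φ Sbar = s ∧ φ (Sbar * Tbar) = r := by
  refine ⟨(freeProductHom s r hs hr).comp freeProductEquivPSL2Z.symm.toMonoidHom, ?_, ?_⟩
  · have h : freeProductEquivPSL2Z.symm Sbar = factorGen false :=
      freeProductEquivPSL2Z.symm_apply_eq.2
        (freeProductHom_factorGen_false _ _ Sbar_sq Sbar_mul_Tbar_cube).symm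
    exact (congrArg _ h).trans (freeProductHom_factorGen_false s r hs hr)
  · have h : freeProductEquivPSL2Z.symm (Sbar * Tbar) = factorGen true :=
      freeProductEquivPSL2Z.symm_apply_eq.2
        (freeProductHom_factorGen_true _ _ Sbar_sq Sbar_mul_Tbar_cube).symm
    exact (congrArg _ h).trans (freeProductHom_factorGen_true s r hs hr)

/-- If a homomorphism to a permutation group has transitive image, then point stabilizers have
index the number of points. -/
lemma index_comap_stabilizer_of_transitive {G X : Type*} [Group G] (φ : G →* Equiv.Perm X)
    (h : ∀ x y : X, ∃ g ∈ φ.range, g x = y) (x : X) :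
    ((MulAction.stabilizer (Equiv.Perm X) x).comap φ).index = Nat.card X := by
  let : MulAction G X := MulAction.compHom X φ
  have : MulAction.IsPretransitive G X := ⟨fun x y => by
    obtain ⟨_, ⟨g, rfl⟩, hg⟩ := h x y
    exact ⟨g, hg⟩⟩
  exact MulAction.index_stabilizer_of_transitive G x

/-- For any permutations `σ_S, σ_R` of `Fin μ` with `σ_S² = 1` and `σ_R³ = 1` there is a group
homomorphism `φ : PSL(2, ℤ) → Perm (Fin μ)` with `φ(S) = σ_S` and `φ(S·T) = σ_R`. Moreover, if
the subgroup generated by `σ_S` and `σ_R` acts transitively on `Fin μ`, then the stabilizer of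
`0 : Fin μ` under the induced action is a subgroup of `PSL(2, ℤ)` of index `μ`. -/
theorem millington_homomorphism (μ : ℕ) (hμ : 1 ≤ μ)
    (σS σR : Equiv.Perm (Fin μ)) (hS : σS ^ 2 = 1) (hR : σR ^ 3 = 1) :
    ∃ φ : PSL2Z →* Equiv.Perm (Fin μ),
      φ Sbar = σS ∧ φ (Sbar * Tbar) = σR ∧
      ((∀ i j : Fin μ, ∃ g ∈ Subgroup.closure {σS, σR}, g i = j) →
        (Subgroup.comap φ
          (MulAction.stabilizer (Equiv.Perm (Fin μ)) (⟨0, hμ⟩ : Fin μ))).index = μ) := by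
  obtain ⟨φ, hφS, hφR⟩ := exists_monoidHom_PSL2Z σS σR hS hR
  refine ⟨φ, hφS, hφR, fun htrans => ?_⟩
  have hle : Subgroup.closure {σS, σR} ≤ φ.range := by
    rw [Subgroup.closure_le]
    rintro x (rfl | rfl)
    · exact ⟨_, hφS⟩
    · exact ⟨_, hφR⟩
  rw [index_comap_stabilizer_of_transitive φ (fun i j => ?_), Nat.card_fin]
  obtain ⟨g, hg, hgij⟩ := htrans i j
  exact ⟨g, hle hg, hgij⟩
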